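/- Let T be an ABC-tile having exactly 14 neighbors. Then for any distinct α, β ∈ ℤ³ \ {0} with T ∩ (T + α) ∩ (T + β) ≠ ∅, the set T ∩ (T + α) ∩ (T + β) is a Peano continuum: it is compact, connected, and locally connected. -/

import Mathlib

open MeasureTheory

noncomputable def Mmat (A B C : ℤ) : Matrix (Fin 3) (Fin 3) ℝ :=
  !![0, 0, -(C : ℝ); 1, 0, -(B : ℝ); 0, 1, -(A : ℝ)]

def Ddig (C : ℤ) : Set (Fin 3 → ℝ) :=
  {d | ∃ i : ℤ, 0 ≤ i ∧ i < C ∧ d = ![(i : ℝ), 0, 0]}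

def toR (α : Fin 3 → ℤ) : Fin 3 → ℝ := fun i => (α i : ℝ)

def tileTranslate (v : Fin 3 → ℝ) (T : Set (Fin 3 → ℝ)) : Set (Fin 3 → ℝ) :=
  (fun x => x + v) '' T

def IsABCTile (A B C : ℤ) (T : Set (Fin 3 → ℝ)) : Prop :=
  1 ≤ A ∧ A ≤ B ∧ B < C ∧
  T.Nonempty ∧ IsCompact T ∧ 0 < volume T ∧
  (Mmat A B C).mulVec '' T = ⋃ d ∈ Ddig C, tileTranslate d T

def Neighbors (T : Set (Fin 3 → ℝ)) : Set (Fin 3 → ℤ) :=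
  {α | α ≠ 0 ∧ (T ∩ tileTranslate (toR α) T).Nonempty}

open Filter Topology

/-- The linear map given by `Mmat`. -/
noncomputable def ML (A B C : ℤ) : Module.End ℝ (Fin 3 → ℝ) := (Mmat A B C).mulVecLin

/-- The inverse of `ML`. -/
noncomputable def NL (A B C : ℤ) : Module.End ℝ (Fin 3 → ℝ) :=
  (!![-(B : ℝ) / C, 1, 0; -(A : ℝ) / C, 0, 1; -1 / (C : ℝ), 0, 0] :
    Matrix (Fin 3) (Fin 3) ℝ).mulVecLin

lemma ML_apply (A B C : ℤ) (x : Fin 3 → ℝ) :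
    ML A B C x = ![-(C : ℝ) * x 2, x 0 - B * x 2, x 1 - A * x 2] := by
  ext i
  fin_cases i <;> simp [ML, Mmat, Matrix.mulVec, dotProduct, Fin.sum_univ_three] <;> ring

lemma NL_apply (A B C : ℤ) (x : Fin 3 → ℝ) :
    NL A B C x = ![-(B : ℝ) / C * x 0 + x 1, -(A : ℝ) / C * x 0 + x 2, -1 / (C : ℝ) * x 0] := by
  ext i
  fin_cases i <;> simp [NL, Matrix.mulVec, dotProduct, Fin.sum_univ_three]

lemma NL_ML {A B C : ℤ} (hC : 0 < C) (x : Fin 3 → ℝ) : NL A B C (ML A B C x) = x := by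
  have hC' : (C : ℝ) ≠ 0 := by exact_mod_cast hC.ne'
  rw [NL_apply, ML_apply]
  ext i
  fin_cases i <;> simp <;> field_simp <;> ring

lemma ML_NL {A B C : ℤ} (hC : 0 < C) (x : Fin 3 → ℝ) : ML A B C (NL A B C x) = x := by
  have hC' : (C : ℝ) ≠ 0 := by exact_mod_cast hC.ne'
  rw [NL_apply, ML_apply]
  ext i
  fin_cases i <;> simp <;> field_simp <;> ring

/-- Scalar recurrence: solutions tend to zero. -/
lemma rec_tendsto {A B C : ℝ} (hA : 1 ≤ A) (hAB : A ≤ B) (hBC : B < C) (s : ℕ → ℝ)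
    (hs : ∀ n, C * s (n + 3) + B * s (n + 2) + A * s (n + 1) + s n = 0) :
    Tendsto s atTop (𝓝 0) := by
  set V : ℕ → ℝ := fun n => C * s (n + 3) ^ 2 + B * s (n + 2) ^ 2 + A * s (n + 1) ^ 2 + s n ^ 2
    with hV
  have hdiff : ∀ n, V n - V (n + 1) = (C - B) * (s (n + 3) - s (n + 4)) ^ 2
      + (B - A) * (s (n + 2) - s (n + 4)) ^ 2 + (A - 1) * (s (n + 1) - s (n + 4)) ^ 2
      + (s n - s (n + 4)) ^ 2 := by
    intro n
    have h1 := hs n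
    have h2 := hs (n + 1)
    simp only [hV]
    have e1 : n + 1 + 3 = n + 4 := by ring
    have e2 : n + 1 + 2 = n + 3 := by ring
    have e3 : n + 1 + 1 = n + 2 := by ring
    simp only [e1, e2, e3] at h2 ⊢
    linear_combination (2 * s (n + 4)) * h1 - (2 * s (n + 4)) * h2
  have hanti : Antitone V := by
    apply antitone_nat_of_succ_le
    intro n
    have h := hdiff n
    have : 0 ≤ V n - V (n + 1) := by
      rw [h]
      have := sub_nonneg.2 hBC.le
      have := sub_nonneg.2 hAB
      have := sub_nonneg.2 hA
      positivity
    linarith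
  have hbdd : BddBelow (Set.range V) := by
    refine ⟨0, ?_⟩
    rintro _ ⟨n, rfl⟩
    have : 0 ≤ A := by linarith
    have : 0 ≤ B := by linarith
    have : 0 ≤ C := by linarith
    simp only [hV]
    positivity
  have hlim := tendsto_atTop_ciInf hanti hbdd
  have hlim' : Tendsto (fun n => V n - V (n + 1)) atTop (𝓝 0) := by
    simpa using hlim.sub ((tendsto_add_atTop_iff_nat 1).2 hlim)
  have hd2 : Tendsto (fun n => (s (n + 3) - s (n + 4)) ^ 2) atTop (𝓝 0) := by
    have h2 : Tendsto (fun n => (V n - V (n + 1)) / (C - B)) atTop (𝓝 0) := by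
      simpa using hlim'.div_const (C - B)
    refine squeeze_zero (fun n => sq_nonneg _) (fun n => ?_) h2
    rw [le_div_iff₀ (sub_pos.2 hBC), hdiff n]
    have h3 := mul_nonneg (sub_nonneg.2 hAB) (sq_nonneg (s (n + 2) - s (n + 4)))
    have h4 := mul_nonneg (sub_nonneg.2 hA) (sq_nonneg (s (n + 1) - s (n + 4)))
    nlinarith [sq_nonneg (s n - s (n + 4))]
  have hd : Tendsto (fun n => s (n + 3) - s (n + 4)) atTop (𝓝 0) := by
    have := hd2.sqrt
    simp only [Real.sqrt_sq_eq_abs, Real.sqrt_zero] at this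
    exact tendsto_zero_iff_abs_tendsto_zero _ |>.2 this
  have hd0 : Tendsto (fun n => s n - s (n + 1)) atTop (𝓝 0) :=
    (tendsto_add_atTop_iff_nat (f := fun n => s n - s (n + 1)) 3).1 hd
  have hd1 : Tendsto (fun n => s (n + 1) - s (n + 2)) atTop (𝓝 0) :=
    (tendsto_add_atTop_iff_nat (f := fun n => s n - s (n + 1)) 1).2 hd0
  have hd2' : Tendsto (fun n => s (n + 2) - s (n + 3)) atTop (𝓝 0) :=
    (tendsto_add_atTop_iff_nat (f := fun n => s n - s (n + 1)) 2).2 hd0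
  have hcomb := (((hd0.const_mul (A + B + C)).add (hd1.const_mul (B + C))).add
    (hd2'.const_mul C)).div_const (A + B + C + 1)
  have hpos : A + B + C + 1 ≠ 0 := by
    have : 0 < A + B + C + 1 := by linarith
    exact this.ne'
  refine (hcomb.congr ?_).trans_eq ?_
  · intro n
    rw [div_eq_iff hpos]
    linear_combination -hs n
  · simp

lemma NL_pow_tendsto {A B C : ℤ} (hA : 1 ≤ A) (hAB : A ≤ B) (hBC : B < C) (x : Fin 3 → ℝ) :
    Tendsto (fun n => (NL A B C ^ n) x) atTop (𝓝 0) := by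
  have hC' : (C : ℝ) ≠ 0 := by
    have : C ≠ 0 := by omega
    exact_mod_cast this
  set y : ℕ → Fin 3 → ℝ := fun n => (NL A B C ^ n) x with hy
  have hstep : ∀ n, y (n + 1) = NL A B C (y n) := by
    intro n
    simp only [hy, pow_succ', Module.End.mul_apply]
  have h0 : ∀ n, y (n + 1) 0 = -(B : ℝ) / C * y n 0 + y n 1 := fun n => by
    rw [hstep, NL_apply]; simp
  have h1 : ∀ n, y (n + 1) 1 = -(A : ℝ) / C * y n 0 + y n 2 := fun n => by
    rw [hstep, NL_apply]; simp
  have h2 : ∀ n, y (n + 1) 2 = -1 / (C : ℝ) * y n 0 := fun n => by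
    rw [hstep, NL_apply]; simp
  have t0 : Tendsto (fun n => y n 0) atTop (𝓝 0) := by
    refine rec_tendsto (A := A) (B := B) (C := C) (by exact_mod_cast hA) (by exact_mod_cast hAB)
      (by exact_mod_cast hBC) _ ?_
    intro n
    have e0 := h0 (n + 2)
    have e1 := h1 (n + 1)
    have e2 := h2 n
    simp only [show n + 1 + 1 = n + 2 from rfl, show n + 2 + 1 = n + 3 from rfl] at e0 e1
    rw [e0, e1, e2]
    field_simp
    ring
  have t2 : Tendsto (fun n => y n 2) atTop (𝓝 0) := by
    rw [← tendsto_add_atTop_iff_nat 1]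
    simp only [h2]
    simpa using t0.const_mul (-1 / (C : ℝ))
  have t1 : Tendsto (fun n => y n 1) atTop (𝓝 0) := by
    rw [← tendsto_add_atTop_iff_nat 1]
    simp only [h1]
    simpa using (t0.const_mul (-(A : ℝ) / C)).add t2
  rw [tendsto_pi_nhds]
  intro i
  fin_cases i
  · exact t0
  · exact t1
  · exact t2

lemma NL_pow_ML_pow {A B C : ℤ} (hC : 0 < C) (n : ℕ) (x : Fin 3 → ℝ) :
    (NL A B C ^ n) ((ML A B C ^ n) x) = x := by
  induction n with
  | zero => simp
  | succ n ih =>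
    rw [pow_succ, pow_succ', Module.End.mul_apply, Module.End.mul_apply, NL_ML hC, ih]

lemma expanding {A B C : ℤ} (hA : 1 ≤ A) (hAB : A ≤ B) (hBC : B < C) (R ε : ℝ) (hε : 0 < ε) :
    ∃ n : ℕ, ∀ v : Fin 3 → ℝ, ‖(ML A B C ^ n) v‖ ≤ R → ‖v‖ < ε := by
  have hsum : Tendsto (fun n => |R| * (‖(NL A B C ^ n) (Pi.single 0 1)‖
      + ‖(NL A B C ^ n) (Pi.single 1 1)‖ + ‖(NL A B C ^ n) (Pi.single 2 1)‖)) atTop (𝓝 0) := by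
    have t := fun i : Fin 3 => (NL_pow_tendsto hA hAB hBC (Pi.single i 1)).norm
    simpa using (((t 0).add (t 1)).add (t 2)).const_mul |R|
  obtain ⟨n, hn⟩ := (hsum.eventually (gt_mem_nhds hε)).exists
  refine ⟨n, fun v hv => ?_⟩
  set w := (ML A B C ^ n) v with hw
  have hvw : v = (NL A B C ^ n) w := (NL_pow_ML_pow (by omega) n v).symm
  have hdec : w = w 0 • (Pi.single 0 1 : Fin 3 → ℝ) + w 1 • (Pi.single 1 1 : Fin 3 → ℝ)
      + w 2 • (Pi.single 2 1 : Fin 3 → ℝ) := by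
    ext i
    fin_cases i <;> simp
  have hb : ∀ i, ‖w i‖ ≤ |R| := fun i => (norm_le_pi_norm w i).trans (hv.trans (le_abs_self R))
  refine lt_of_le_of_lt ?_ hn
  rw [hvw, hdec, map_add, map_add, map_smul, map_smul, map_smul]
  refine (norm_add₃_le).trans ?_
  rw [norm_smul, norm_smul, norm_smul, mul_add, mul_add]
  gcongr <;> exact hb _
/-! ### General topology -/

lemma preconnected_of_chain {X : Set (Fin 3 → ℝ)} (hX : IsCompact X)
    (h : ∀ ε > 0, ∀ x ∈ X, ∀ y ∈ X,
      Relation.ReflTransGen (fun u v => u ∈ X ∧ v ∈ X ∧ dist u v < ε) x y) :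
    IsPreconnected X := by
  rw [isPreconnected_closed_iff]
  rintro t t' ht ht' hsub ⟨x, hxX, hxt⟩ ⟨y, hyX, hyt⟩
  by_contra hcon
  have hdisj : Disjoint (X ∩ t) (X ∩ t') := by
    rw [Set.disjoint_left]
    rintro z ⟨hz, hzt⟩ ⟨_, hzt'⟩
    exact hcon ⟨z, hz, hzt, hzt'⟩
  obtain ⟨δ, hδ, hth⟩ := hdisj.exists_thickenings (hX.inter_right ht) (hX.isClosed.inter ht')
  have key : ∀ z, Relation.ReflTransGen (fun u v => u ∈ X ∧ v ∈ X ∧ dist u v < δ) x z →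
      z ∈ X ∩ t := by
    intro z hz
    induction hz with
    | refl => exact ⟨hxX, hxt⟩
    | @tail u v _ huv ih =>
      obtain ⟨hu, hv, hd⟩ := huv
      refine ⟨hv, ?_⟩
      rcases hsub hv with h1 | h1
      · exact h1
      · exfalso
        refine (Set.disjoint_left.1 hth : ∀ ⦃a⦄, _ → _) (a := v) ?_ ?_
        · exact Metric.mem_thickening_iff.2 ⟨u, ih, by rwa [dist_comm]⟩
        · exact Metric.mem_thickening_iff.2 ⟨v, ⟨hv, h1⟩, by simpa using hδ⟩
  have := key y (h δ hδ x hxX y hyX)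
  exact hcon ⟨y, hyX, this.2, hyt⟩

lemma locallyConnected_of_cover {X : Set (Fin 3 → ℝ)}
    (h : ∀ ε > 0, ∃ P : Set (Set (Fin 3 → ℝ)), P.Finite ∧ ⋃₀ P = X ∧
      ∀ p ∈ P, IsClosed p ∧ IsPreconnected p ∧ ∀ x ∈ p, ∀ y ∈ p, dist x y < ε) :
    LocallyConnectedSpace X := by
  rw [locallyConnectedSpace_iff_connected_subsets]
  intro x U hU
  obtain ⟨ε, hε, hball⟩ := Metric.mem_nhds_iff.1 hU
  obtain ⟨P, hfin, hcov, hP⟩ := h ε hε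
  set V : Set (Fin 3 → ℝ) := ⋃₀ {p ∈ P | (x : Fin 3 → ℝ) ∈ p} with hV
  have hVX : V ⊆ X := by
    rw [← hcov]
    exact Set.sUnion_subset_sUnion (fun p hp => hp.1)
  have hVpre : IsPreconnected V :=
    isPreconnected_sUnion (x : Fin 3 → ℝ) _ (fun p hp => hp.2) (fun p hp => (hP p hp.1).2.1)
  have hclosed : IsClosed (⋃₀ {p ∈ P | (x : Fin 3 → ℝ) ∉ p}) :=
    by
    rw [Set.sUnion_eq_biUnion]
    exact (hfin.subset (Set.sep_subset P _)).isClosed_biUnion (fun p hp => (hP p hp.1).1)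
  refine ⟨Subtype.val ⁻¹' V, ?_, ?_, ?_⟩
  · have hopen : IsOpen ((Subtype.val : X → Fin 3 → ℝ) ⁻¹' (⋃₀ {p ∈ P | (x : Fin 3 → ℝ) ∉ p})ᶜ) :=
      hclosed.isOpen_compl.preimage continuous_subtype_val
    refine Filter.mem_of_superset (hopen.mem_nhds ?_) ?_
    · rintro ⟨p, hp, hxp⟩
      exact hp.2 hxp
    · intro z hz
      have hzX : (z : Fin 3 → ℝ) ∈ ⋃₀ P := by rw [hcov]; exact z.2
      obtain ⟨p, hp, hzp⟩ := hzX
      by_cases hxp : (x : Fin 3 → ℝ) ∈ p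
      · exact ⟨p, ⟨hp, hxp⟩, hzp⟩
      · exact absurd ⟨p, ⟨hp, hxp⟩, hzp⟩ hz
  · refine (Topology.IsInducing.subtypeVal.isPreconnected_image).1 ?_
    rwa [Subtype.image_preimage_coe, Set.inter_eq_right.2 hVX]
  · rintro z ⟨p, ⟨hp, hxp⟩, hzp⟩
    exact hball ((hP p hp).2.2 z hzp x hxp)
/-! ### Lattice coordinates and tiles -/

/-- The lattice point `p P + q Q + n N` with `P = (1,0,0)`, `Q = (A,1,0)`, `N = (B,A,1)`. -/
def pos (A B : ℤ) (v : ℤ × ℤ × ℤ) : Fin 3 → ℝ :=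
  ![(v.1 : ℝ) + A * v.2.1 + B * v.2.2, (v.2.1 : ℝ) + A * v.2.2, (v.2.2 : ℝ)]

/-- The tile at a lattice point. -/
def Tl (A B : ℤ) (T : Set (Fin 3 → ℝ)) (v : ℤ × ℤ × ℤ) : Set (Fin 3 → ℝ) :=
  {x | x - pos A B v ∈ T}

/-- The action of `M` on lattice points, followed by the addition of the digit `i`. -/
def phi (A B C : ℤ) (v : ℤ × ℤ × ℤ) (i : ℤ) : ℤ × ℤ × ℤ :=
  (-A * v.1 - B * v.2.1 - C * v.2.2 + i, v.1, v.2.1)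

lemma pos_add (A B : ℤ) (v w : ℤ × ℤ × ℤ) : pos A B (v + w) = pos A B v + pos A B w := by
  ext i
  fin_cases i <;> simp [pos] <;> ring

lemma pos_sub (A B : ℤ) (v w : ℤ × ℤ × ℤ) : pos A B (v - w) = pos A B v - pos A B w := by
  ext i
  fin_cases i <;> simp [pos] <;> ring

lemma pos_phi (A B C : ℤ) (v : ℤ × ℤ × ℤ) (i : ℤ) :
    pos A B (phi A B C v i) = ML A B C (pos A B v) + pos A B (i, 0, 0) := by
  rw [ML_apply]
  ext j
  fin_cases j <;> simp [pos, phi] <;> ring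

/-- Pointwise form of the set equation. -/
def SelfSim (A B C : ℤ) (T : Set (Fin 3 → ℝ)) : Prop :=
  ∀ x, x ∈ T ↔ ∃ i : ℤ, 0 ≤ i ∧ i < C ∧ ML A B C x - pos A B (i, 0, 0) ∈ T

lemma selfSim_of_tile {A B C : ℤ} {T : Set (Fin 3 → ℝ)} (hC : 0 < C)
    (h : (Mmat A B C).mulVec '' T = ⋃ d ∈ Ddig C, tileTranslate d T) : SelfSim A B C T := by
  intro x
  have h1 : x ∈ T ↔ ML A B C x ∈ (Mmat A B C).mulVec '' T := by
    constructor
    · intro hx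
      exact ⟨x, hx, rfl⟩
    · rintro ⟨y, hy, hxy⟩
      have : ML A B C y = ML A B C x := hxy
      have h2 := congrArg (NL A B C) this
      rw [NL_ML hC, NL_ML hC] at h2
      rwa [← h2]
  have hp : ∀ i : ℤ, pos A B (i, 0, 0) = ![(i : ℝ), 0, 0] := by
    intro i
    ext j
    fin_cases j <;> simp [pos]
  rw [h1, h]
  simp only [Set.mem_iUnion, Ddig, Set.mem_ofPred_eq, tileTranslate, Set.mem_image, hp]
  constructor
  · rintro ⟨d, ⟨i, hi0, hiC, rfl⟩, t, ht, htx⟩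
    refine ⟨i, hi0, hiC, ?_⟩
    rw [← htx, add_sub_cancel_right]
    exact ht
  · rintro ⟨i, hi0, hiC, ht⟩
    exact ⟨_, ⟨i, hi0, hiC, rfl⟩, _, ht, sub_add_cancel _ _⟩

lemma mem_Tl_iff {A B C : ℤ} {T : Set (Fin 3 → ℝ)} (hS : SelfSim A B C T) (v : ℤ × ℤ × ℤ)
    (x : Fin 3 → ℝ) :
    x ∈ Tl A B T v ↔ ∃ i : ℤ, 0 ≤ i ∧ i < C ∧ ML A B C x ∈ Tl A B T (phi A B C v i) := by
  simp only [Tl, Set.mem_ofPred_eq]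
  rw [hS]
  simp only [pos_phi, map_sub, sub_sub]

lemma mem_Tl_add {A B : ℤ} {T : Set (Fin 3 → ℝ)} (v w : ℤ × ℤ × ℤ) (x : Fin 3 → ℝ) :
    x + pos A B w ∈ Tl A B T (v + w) ↔ x ∈ Tl A B T v := by
  simp only [Tl, Set.mem_ofPred_eq, pos_add, add_sub_add_right_eq_sub]

lemma isClosed_Tl {A B : ℤ} {T : Set (Fin 3 → ℝ)} (hT : IsCompact T) (v : ℤ × ℤ × ℤ) :
    IsClosed (Tl A B T v) :=
  hT.isClosed.preimage (by fun_prop : Continuous fun x : Fin 3 → ℝ => x - pos A B v)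

lemma isCompact_Tl {A B : ℤ} {T : Set (Fin 3 → ℝ)} (hT : IsCompact T) (v : ℤ × ℤ × ℤ) :
    IsCompact (Tl A B T v) := by
  have : Tl A B T v = (fun x => x + pos A B v) '' T := by
    ext x
    constructor
    · intro hx
      exact ⟨x - pos A B v, hx, by simp⟩
    · rintro ⟨y, hy, rfl⟩
      simpa [Tl] using hy
  rw [this]
  exact hT.image (by fun_prop)

/-! ### Quadruple points -/

/-- The six pairs of neighbours which complete `{0, P}` to a quadruple. -/
def Edge (w u : ℤ × ℤ × ℤ) : Prop :=
  (w = (0, 1, 0) ∧ u = (0, 0, 1)) ∨ (w = (0, 0, 1) ∧ u = (1, -1, 1)) ∨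
  (w = (1, -1, 1) ∧ u = (1, -1, 0)) ∨ (w = (1, -1, 0) ∧ u = (1, 0, -1)) ∨
  (w = (1, 0, -1) ∧ u = (0, 1, -1)) ∨ (w = (0, 1, -1) ∧ u = (0, 1, 0))

/-- The quadruple of lattice points based at `a`. -/
def quad (a w u : ℤ × ℤ × ℤ) : Fin 4 → ℤ × ℤ × ℤ := ![a, a + (1, 0, 0), a + w, a + u]

lemma quad_step {A B C : ℤ} (hA : 1 ≤ A) (hAB : A ≤ B) (hBC : B < C) {a w u : ℤ × ℤ × ℤ}
    (h : Edge w u) : ∃ a' w' u', Edge w' u' ∧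
      ∀ m : Fin 4, ∃ i : ℤ, 0 ≤ i ∧ i < C ∧ ∃ m', phi A B C (quad a w u m) i = quad a' w' u' m' := by
  obtain ⟨p, q, n⟩ := a
  rcases h with ⟨rfl, rfl⟩ | ⟨rfl, rfl⟩ | ⟨rfl, rfl⟩ | ⟨rfl, rfl⟩ | ⟨rfl, rfl⟩ | ⟨rfl, rfl⟩
  · refine ⟨phi A B C (p, q, n) (-1), (0, 1, 0), (0, 0, 1), by simp [Edge], fun m => ?_⟩
    fin_cases m
    · exact ⟨0, by omega, by omega, 1, by ext <;> simp [phi, quad] <;> ring⟩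
    · exact ⟨A - 1, by omega, by omega, 2, by ext <;> simp [phi, quad] <;> ring⟩
    · exact ⟨B - 1, by omega, by omega, 3, by ext <;> simp [phi, quad] <;> ring⟩
    · exact ⟨C - 1, by omega, by omega, 0, by ext <;> simp [phi, quad] <;> ring⟩
  · refine ⟨phi A B C (p, q, n) (-1), (0, 1, -1), (0, 1, 0), by simp [Edge], fun m => ?_⟩
    fin_cases m
    · exact ⟨0, by omega, by omega, 1, by ext <;> simp [phi, quad] <;> ring⟩
    · exact ⟨A - 1, by omega, by omega, 3, by ext <;> simp [phi, quad] <;> ring⟩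
    · exact ⟨C - 1, by omega, by omega, 0, by ext <;> simp [phi, quad] <;> ring⟩
    · exact ⟨C + A - B - 1, by omega, by omega, 2, by ext <;> simp [phi, quad] <;> ring⟩
  · refine ⟨phi A B C (p + 1, q - 1, n) (-1), (0, 0, 1), (1, -1, 1), by simp [Edge], fun m => ?_⟩
    fin_cases m
    · exact ⟨B - A, by omega, by omega, 3, by ext <;> simp [phi, quad] <;> ring⟩
    · exact ⟨B - 1, by omega, by omega, 2, by ext <;> simp [phi, quad] <;> ring⟩
    · exact ⟨C - 1, by omega, by omega, 0, by ext <;> simp [phi, quad] <;> ring⟩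
    · exact ⟨0, by omega, by omega, 1, by ext <;> simp [phi, quad] <;> first | ring1 | (left; ring1)⟩
  · refine ⟨phi A B C (p + 1, q, n - 1) (-1), (1, -1, 0), (1, 0, -1), by simp [Edge], fun m => ?_⟩
    fin_cases m
    · exact ⟨C - A, by omega, by omega, 2, by ext <;> simp [phi, quad] <;> ring⟩
    · exact ⟨C - 1, by omega, by omega, 0, by ext <;> simp [phi, quad] <;> ring⟩
    · exact ⟨C - B, by omega, by omega, 3, by ext <;> simp [phi, quad] <;> ring⟩
    · exact ⟨0, by omega, by omega, 1, by ext <;> simp [phi, quad] <;> first | ring1 | (left; ring1)⟩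
  · refine ⟨phi A B C (p + 1, q, n - 1) (-1), (1, -1, 1), (1, -1, 0), by simp [Edge], fun m => ?_⟩
    fin_cases m
    · exact ⟨C - A, by omega, by omega, 3, by ext <;> simp [phi, quad] <;> ring⟩
    · exact ⟨C - 1, by omega, by omega, 0, by ext <;> simp [phi, quad] <;> ring⟩
    · exact ⟨0, by omega, by omega, 1, by ext <;> simp [phi, quad] <;> first | ring1 | (left; ring1)⟩
    · exact ⟨B - A, by omega, by omega, 2, by ext <;> simp [phi, quad] <;> ring⟩
  · refine ⟨phi A B C (p, q + 1, n - 1) (-1), (1, 0, -1), (0, 1, -1), by simp [Edge], fun m => ?_⟩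
    fin_cases m
    · exact ⟨C - B, by omega, by omega, 2, by ext <;> simp [phi, quad] <;> ring⟩
    · exact ⟨C + A - B - 1, by omega, by omega, 3, by ext <;> simp [phi, quad] <;> ring⟩
    · exact ⟨0, by omega, by omega, 1, by ext <;> simp [phi, quad] <;> first | ring1 | (left; ring1)⟩
    · exact ⟨C - 1, by omega, by omega, 0, by ext <;> simp [phi, quad] <;> ring⟩

lemma quad_bound (A B : ℤ) : ∃ R : ℝ, ∀ a w u : ℤ × ℤ × ℤ, Edge w u →
    ∀ m, ‖pos A B (quad a w u m) - pos A B a‖ ≤ R := by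
  refine ⟨‖pos A B (1, 0, 0)‖ + ‖pos A B (0, 1, 0)‖ + ‖pos A B (0, 0, 1)‖
    + ‖pos A B (1, -1, 1)‖ + ‖pos A B (1, -1, 0)‖ + ‖pos A B (1, 0, -1)‖
    + ‖pos A B (0, 1, -1)‖, fun a w u h m => ?_⟩
  have h1 := norm_nonneg (pos A B (1, 0, 0))
  have h2 := norm_nonneg (pos A B (0, 1, 0))
  have h3 := norm_nonneg (pos A B (0, 0, 1))
  have h4 := norm_nonneg (pos A B (1, -1, 1))
  have h5 := norm_nonneg (pos A B (1, -1, 0))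
  have h6 := norm_nonneg (pos A B (1, 0, -1))
  have h7 := norm_nonneg (pos A B (0, 1, -1))
  rcases h with ⟨rfl, rfl⟩ | ⟨rfl, rfl⟩ | ⟨rfl, rfl⟩ | ⟨rfl, rfl⟩ | ⟨rfl, rfl⟩ | ⟨rfl, rfl⟩ <;>
    fin_cases m <;> simp [quad, pos_add] <;> linarith

lemma quad_approx {A B C : ℤ} {T : Set (Fin 3 → ℝ)} (hA : 1 ≤ A) (hAB : A ≤ B) (hBC : B < C)
    (hS : SelfSim A B C T) (hT : T.Nonempty) : ∃ R : ℝ, ∀ n : ℕ, ∀ a w u : ℤ × ℤ × ℤ, Edge w u →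
      ∃ c, ∀ m, ∃ t ∈ Tl A B T (quad a w u m), ‖(ML A B C ^ n) t - c‖ ≤ R := by
  obtain ⟨R, hR⟩ := quad_bound A B
  obtain ⟨t₀, ht₀⟩ := hT
  refine ⟨R, fun n => ?_⟩
  induction n with
  | zero =>
    intro a w u h
    refine ⟨t₀ + pos A B a, fun m => ⟨t₀ + pos A B (quad a w u m), by simpa [Tl] using ht₀, ?_⟩⟩
    simpa using hR a w u h m
  | succ n ih =>
    intro a w u h
    obtain ⟨a', w', u', h', hstep⟩ := quad_step hA hAB hBC (a := a) h
    obtain ⟨c, hc⟩ := ih a' w' u' h'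
    refine ⟨c, fun m => ?_⟩
    obtain ⟨i, hi0, hiC, m', hm'⟩ := hstep m
    obtain ⟨t, ht, htc⟩ := hc m'
    refine ⟨NL A B C t, ?_, ?_⟩
    · rw [mem_Tl_iff hS]
      refine ⟨i, hi0, hiC, ?_⟩
      rw [ML_NL (by omega), hm']
      exact ht
    · rw [pow_succ, Module.End.mul_apply, ML_NL (by omega)]
      exact htc

lemma quad_nonempty {A B C : ℤ} {T : Set (Fin 3 → ℝ)} (hA : 1 ≤ A) (hAB : A ≤ B) (hBC : B < C)
    (hS : SelfSim A B C T) (hT : T.Nonempty) (hTc : IsCompact T) (a w u : ℤ × ℤ × ℤ)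
    (h : Edge w u) : ∃ x, ∀ m, x ∈ Tl A B T (quad a w u m) := by
  obtain ⟨R, hR⟩ := quad_approx hA hAB hBC hS hT
  set K : Set (Fin 4 → Fin 3 → ℝ) := Set.univ.pi (fun m => Tl A B T (quad a w u m)) with hK
  have hKc : IsCompact K := isCompact_univ_pi (fun m => isCompact_Tl hTc _)
  have hclose : ∀ ε > 0, ∃ t ∈ K, ∀ m, dist (t m) (t 0) < ε := by
    intro ε hε
    obtain ⟨n, hn⟩ := expanding hA hAB hBC (R + R) ε hε
    obtain ⟨c, hc⟩ := hR n a w u h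
    choose t ht htc using hc
    refine ⟨t, fun m _ => ht m, fun m => ?_⟩
    rw [dist_eq_norm]
    apply hn
    rw [map_sub]
    have e : (ML A B C ^ n) (t m) - (ML A B C ^ n) (t 0)
        = ((ML A B C ^ n) (t m) - c) - ((ML A B C ^ n) (t 0) - c) := by abel
    rw [e]
    exact (norm_sub_le _ _).trans (add_le_add (htc m) (htc 0))
  have hKne : K.Nonempty := by
    obtain ⟨t, ht, _⟩ := hclose 1 one_pos
    exact ⟨t, ht⟩
  have hcont : ContinuousOn (fun t : Fin 4 → Fin 3 → ℝ => dist t (fun _ => t 0)) K := by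
    fun_prop
  obtain ⟨t, htK, hmin⟩ := hKc.exists_isMinOn hKne hcont
  have hzero : dist t (fun _ => t 0) = 0 := by
    refine le_antisymm (le_of_forall_pos_le_add fun ε hε => ?_) dist_nonneg
    obtain ⟨t', ht', hd⟩ := hclose ε hε
    refine (hmin ht').trans ?_
    rw [zero_add]
    exact (dist_pi_le_iff hε.le).2 (fun m => (hd m).le)
  have heq : t = fun _ => t 0 := dist_eq_zero.1 hzero
  refine ⟨t 0, fun m => ?_⟩
  have h1 : t m ∈ Tl A B T (quad a w u m) := htK m (Set.mem_univ m)
  have h2 : t m = t 0 := congrFun heq m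
  rwa [h2] at h1

/-! ### Triples of tiles -/

/-- The fourteen neighbours, sorted by columns. -/
def InS (v : ℤ × ℤ × ℤ) : Prop :=
  (v.2.1 = 0 ∧ v.2.2 = 0 ∧ (v.1 = 1 ∨ v.1 = -1)) ∨
  (v.2.1 = 1 ∧ v.2.2 = 0 ∧ (v.1 = 0 ∨ v.1 = -1)) ∨
  (v.2.1 = -1 ∧ v.2.2 = 0 ∧ (v.1 = 0 ∨ v.1 = 1)) ∨
  (v.2.1 = 0 ∧ v.2.2 = 1 ∧ (v.1 = 0 ∨ v.1 = -1)) ∨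
  (v.2.1 = 0 ∧ v.2.2 = -1 ∧ (v.1 = 0 ∨ v.1 = 1)) ∨
  (v.2.1 = -1 ∧ v.2.2 = 1 ∧ (v.1 = 0 ∨ v.1 = 1)) ∨
  (v.2.1 = 1 ∧ v.2.2 = -1 ∧ (v.1 = 0 ∨ v.1 = -1))

lemma InS.neg {v : ℤ × ℤ × ℤ} (h : InS v) : InS (-v) := by
  obtain ⟨p, q, n⟩ := v
  simp only [InS] at h
  rcases h with ⟨rfl, rfl, rfl | rfl⟩ | ⟨rfl, rfl, rfl | rfl⟩ | ⟨rfl, rfl, rfl | rfl⟩ |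
    ⟨rfl, rfl, rfl | rfl⟩ | ⟨rfl, rfl, rfl | rfl⟩ | ⟨rfl, rfl, rfl | rfl⟩ | ⟨rfl, rfl, rfl | rfl⟩ <;> simp [InS]

lemma InS.symm {v w : ℤ × ℤ × ℤ} (h : InS (v - w)) : InS (w - v) := by
  simpa using h.neg

/-- Three pairwise neighbouring lattice points. -/
def Good3 (a b c : ℤ × ℤ × ℤ) : Prop := InS (b - a) ∧ InS (c - a) ∧ InS (c - b)

lemma Good3.swap12 {a b c : ℤ × ℤ × ℤ} (h : Good3 a b c) : Good3 b a c :=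
  ⟨h.1.symm, h.2.2, h.2.1⟩

lemma Good3.rot {a b c : ℤ × ℤ × ℤ} (h : Good3 a b c) : Good3 c a b :=
  ⟨h.2.1.symm, h.2.2.symm, h.1⟩

lemma edge_of_InS {v w : ℤ × ℤ × ℤ} (hv : InS v) (hv' : InS (v - (1, 0, 0))) (hw : InS w)
    (hw' : InS (w - (1, 0, 0))) (hvw : InS (w - v)) : Edge v w ∨ Edge w v := by
  have six : ∀ v : ℤ × ℤ × ℤ, InS v → InS (v - (1, 0, 0)) →
      v = (0, 1, 0) ∨ v = (0, 0, 1) ∨ v = (1, -1, 1) ∨ v = (1, -1, 0) ∨ v = (1, 0, -1) ∨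
        v = (0, 1, -1) := by
    rintro ⟨p, q, n⟩ h h'
    simp only [InS] at h
    rcases h with ⟨rfl, rfl, rfl | rfl⟩ | ⟨rfl, rfl, rfl | rfl⟩ | ⟨rfl, rfl, rfl | rfl⟩ |
    ⟨rfl, rfl, rfl | rfl⟩ | ⟨rfl, rfl, rfl | rfl⟩ | ⟨rfl, rfl, rfl | rfl⟩ | ⟨rfl, rfl, rfl | rfl⟩ <;>
    revert h' <;> norm_num [InS]
  rcases six v hv hv' with rfl | rfl | rfl | rfl | rfl | rfl <;>
  rcases six w hw hw' with rfl | rfl | rfl | rfl | rfl | rfl <;>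
  revert hvw <;> simp [InS, Edge]

/-- Intersection of three tiles. -/
def Tri (A B : ℤ) (T : Set (Fin 3 → ℝ)) (a b c : ℤ × ℤ × ℤ) : Set (Fin 3 → ℝ) :=
  {x | x ∈ Tl A B T a ∧ x ∈ Tl A B T b ∧ x ∈ Tl A B T c}

lemma link_nonempty {A B C : ℤ} {T : Set (Fin 3 → ℝ)} (hA : 1 ≤ A) (hAB : A ≤ B) (hBC : B < C)
    (hS : SelfSim A B C T) (hT : T.Nonempty) (hTc : IsCompact T) {a b c : ℤ × ℤ × ℤ}
    (h : Good3 a b c) (h' : Good3 (a + (1, 0, 0)) b c) :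
    ∃ x, x ∈ Tl A B T a ∧ x ∈ Tl A B T (a + (1, 0, 0)) ∧ x ∈ Tl A B T b ∧ x ∈ Tl A B T c := by
  obtain ⟨h1, h2, h3⟩ := h
  obtain ⟨h1', h2', _⟩ := h'
  rw [← sub_sub] at h1' h2'
  have h4 : InS ((c - a) - (b - a)) := by simpa using h3
  rcases edge_of_InS h1 h1' h2 h2' h4 with he | he
  · obtain ⟨x, hx⟩ := quad_nonempty hA hAB hBC hS hT hTc a _ _ he
    have e2 := hx 2
    have e3 := hx 3
    simp only [quad, Matrix.cons_val, add_sub_cancel] at e2 e3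
    exact ⟨x, hx 0, hx 1, e2, e3⟩
  · obtain ⟨x, hx⟩ := quad_nonempty hA hAB hBC hS hT hTc a _ _ he
    have e2 := hx 2
    have e3 := hx 3
    simp only [quad, Matrix.cons_val, add_sub_cancel] at e2 e3
    exact ⟨x, hx 0, hx 1, e3, e2⟩

set_option maxHeartbeats 1000000 in
lemma heights {u1 u2 w1 w2 x y z x' y' z' : ℤ}
    (h1 : InS (y - x, u1, u2)) (h2 : InS (z - x, w1, w2)) (h3 : InS (z - y, w1 - u1, w2 - u2))
    (h1' : InS (y' - x', u1, u2)) (h2' : InS (z' - x', w1, w2))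
    (h3' : InS (z' - y', w1 - u1, w2 - u2))
    (hab : u1 = 0 → u2 = 0 → x' = x ∧ y' = y) (hac : w1 = 0 → w2 = 0 → x' = x ∧ z' = z)
    (hbc : w1 = u1 → w2 = u2 → y' = y ∧ z' = z) (hsum : x + y + z ≤ x' + y' + z') :
    (x = x' ∧ y = y' ∧ z = z') ∨
    x + y + z < x' + y' + z' ∧ ((x < x' ∧ InS (y - (x + 1), u1, u2) ∧ InS (z - (x + 1), w1, w2)) ∨
    (y < y' ∧ InS (y + 1 - x, u1, u2) ∧ InS (z - (y + 1), w1 - u1, w2 - u2)) ∨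
    (z < z' ∧ InS (z + 1 - x, w1, w2) ∧ InS (z + 1 - y, w1 - u1, w2 - u2))) := by
  have cols : ∀ p a b : ℤ, InS (p, a, b) → (a = 0 ∧ b = 0) ∨ (a = 1 ∧ b = 0) ∨
      (a = -1 ∧ b = 0) ∨ (a = 0 ∧ b = 1) ∨ (a = 0 ∧ b = -1) ∨ (a = -1 ∧ b = 1) ∨
      (a = 1 ∧ b = -1) := by
    intro p a b h
    simp only [InS] at h
    omega
  have cu := cols _ _ _ h1
  have cw := cols _ _ _ h2
  rcases cu with ⟨rfl, rfl⟩ | ⟨rfl, rfl⟩ | ⟨rfl, rfl⟩ | ⟨rfl, rfl⟩ | ⟨rfl, rfl⟩ | ⟨rfl, rfl⟩ |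
    ⟨rfl, rfl⟩ <;>
  rcases cw with ⟨rfl, rfl⟩ | ⟨rfl, rfl⟩ | ⟨rfl, rfl⟩ | ⟨rfl, rfl⟩ | ⟨rfl, rfl⟩ | ⟨rfl, rfl⟩ |
    ⟨rfl, rfl⟩ <;>
  first
    | (exfalso; revert h3; norm_num [InS]; done)
    | (norm_num [InS] at h1 h2 h3 h1' h2' h3' hab hac hbc ⊢
       rcases h1 with h1 | h1 <;> rcases h2 with h2 | h2 <;>
         first
         | (exfalso; clear h1' h2' h3' hab hac hbc; omega)
         | (obtain rfl := sub_eq_iff_eq_add.1 h1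
            obtain rfl := sub_eq_iff_eq_add.1 h2
            clear h1 h2 h3
            ring_nf
            norm_num
            omega))

lemma coincide {A B C : ℤ} {a b : ℤ × ℤ × ℤ} (h : InS (b - a)) (e1 : b.1 = a.1)
    (e2 : b.2.1 = a.2.1) {i j i' j' : ℤ} (hi : 0 ≤ i ∧ i < C) (hj : 0 ≤ j ∧ j < C)
    (hi' : 0 ≤ i' ∧ i' < C) (hj' : 0 ≤ j' ∧ j' < C)
    (hg : InS (phi A B C b j - phi A B C a i)) (hg' : InS (phi A B C b j' - phi A B C a i')) :
    i' = i ∧ j' = j := by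
  obtain ⟨p, q, n⟩ := a
  obtain ⟨p', q', n'⟩ := b
  simp only at e1 e2
  subst e1 e2
  simp only [InS, Prod.fst_sub, Prod.snd_sub, phi, sub_self] at h hg hg'
  have hn : n' = n + 1 ∨ n' = n - 1 := by omega
  rcases hn with rfl | rfl
  · have e : ∀ s t : ℤ, -A * p' - B * q' - C * (n + 1) + s - (-A * p' - B * q' - C * n + t)
        = s - t - C := by intros; ring
    simp only [e] at hg hg'
    omega
  · have e : ∀ s t : ℤ, -A * p' - B * q' - C * (n - 1) + s - (-A * p' - B * q' - C * n + t)
        = s - t + C := by intros; ring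
    simp only [e] at hg hg'
    omega

/-- Admissible digit triples. -/
def GoodG (A B C : ℤ) (a b c : ℤ × ℤ × ℤ) (g : ℤ × ℤ × ℤ) : Prop :=
  (0 ≤ g.1 ∧ g.1 < C) ∧ (0 ≤ g.2.1 ∧ g.2.1 < C) ∧ (0 ≤ g.2.2 ∧ g.2.2 < C) ∧
    Good3 (phi A B C a g.1) (phi A B C b g.2.1) (phi A B C c g.2.2)

/-- The piece with digit triple `g` of the inflated triple intersection. -/
def TriG (A B C : ℤ) (T : Set (Fin 3 → ℝ)) (a b c g : ℤ × ℤ × ℤ) : Set (Fin 3 → ℝ) :=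
  Tri A B T (phi A B C a g.1) (phi A B C b g.2.1) (phi A B C c g.2.2)

/-- Two admissible pieces that meet. -/
def Link (A B C : ℤ) (T : Set (Fin 3 → ℝ)) (a b c g g' : ℤ × ℤ × ℤ) : Prop :=
  GoodG A B C a b c g ∧ GoodG A B C a b c g' ∧
    ∃ x, x ∈ TriG A B C T a b c g ∧ x ∈ TriG A B C T a b c g'

lemma phi_succ (A B C : ℤ) (v : ℤ × ℤ × ℤ) (i : ℤ) :
    phi A B C v (i + 1) = phi A B C v i + (1, 0, 0) := by
  ext <;> simp [phi]
  ring

lemma link_step {A B C : ℤ} {T : Set (Fin 3 → ℝ)} (hA : 1 ≤ A) (hAB : A ≤ B) (hBC : B < C)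
    (hS : SelfSim A B C T) (hT : T.Nonempty) (hTc : IsCompact T) {a b c : ℤ × ℤ × ℤ}
    (h : Good3 a b c) {g g' : ℤ × ℤ × ℤ} (hg : GoodG A B C a b c g) (hg' : GoodG A B C a b c g')
    (hsum : g.1 + g.2.1 + g.2.2 ≤ g'.1 + g'.2.1 + g'.2.2) :
    g = g' ∨ ∃ g₁ : ℤ × ℤ × ℤ, Link A B C T a b c g g₁ ∧
      g₁.1 + g₁.2.1 + g₁.2.2 = g.1 + g.2.1 + g.2.2 + 1 ∧
      g₁.1 + g₁.2.1 + g₁.2.2 ≤ g'.1 + g'.2.1 + g'.2.2 := by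
  obtain ⟨i, j, k⟩ := g
  obtain ⟨i', j', k'⟩ := g'
  have hgg := hg
  obtain ⟨hi, hj, hk, h1, h2, h3⟩ := hg
  obtain ⟨hi', hj', hk', h1', h2', h3'⟩ := hg'
  simp only at hi hj hk hi' hj' hk' h1 h2 h3 h1' h2' h3' hsum
  set x0 := -A * a.1 - B * a.2.1 - C * a.2.2 with hx0
  set y0 := -A * b.1 - B * b.2.1 - C * b.2.2 with hy0
  set z0 := -A * c.1 - B * c.2.1 - C * c.2.2 with hz0
  have fab : ∀ s t, phi A B C b t - phi A B C a s
      = ((y0 + t) - (x0 + s), b.1 - a.1, b.2.1 - a.2.1) := fun s t => rfl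
  have fac : ∀ s t, phi A B C c t - phi A B C a s
      = ((z0 + t) - (x0 + s), c.1 - a.1, c.2.1 - a.2.1) := fun s t => rfl
  have fbc : ∀ s t, phi A B C c t - phi A B C b s
      = ((z0 + t) - (y0 + s), (c.1 - a.1) - (b.1 - a.1), (c.2.1 - a.2.1) - (b.2.1 - a.2.1)) := by
    intro s t
    rw [sub_sub_sub_cancel_right, sub_sub_sub_cancel_right]
    rfl
  have cab := fun e1 e2 => coincide h.1 e1 e2 hi hj hi' hj' h1 h1'
  have cac := fun e1 e2 => coincide h.2.1 e1 e2 hi hk hi' hk' h2 h2'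
  have cbc := fun e1 e2 => coincide h.2.2 e1 e2 hj hk hj' hk' h3 h3'
  have key := heights (x := x0 + i) (y := y0 + j) (z := z0 + k) (x' := x0 + i') (y' := y0 + j')
    (z' := z0 + k') (u1 := b.1 - a.1) (u2 := b.2.1 - a.2.1) (w1 := c.1 - a.1)
    (w2 := c.2.1 - a.2.1) (by rw [← fab]; exact h1) (by rw [← fac]; exact h2)
    (by rw [← fbc]; exact h3) (by rw [← fab]; exact h1') (by rw [← fac]; exact h2')
    (by rw [← fbc]; exact h3')
    (fun e1 e2 => by have := cab (by omega) (by omega); omega)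
    (fun e1 e2 => by have := cac (by omega) (by omega); omega)
    (fun e1 e2 => by have := cbc (by omega) (by omega); omega) (by omega)
  rcases key with ⟨ex, ey, ez⟩ | ⟨hlt', ⟨hlt, g1, g2⟩ | ⟨hlt, g1, g2⟩ | ⟨hlt, g1, g2⟩⟩
  · left
    ext <;> simp only <;> omega
  · right
    rw [add_assoc x0, ← fab] at g1
    rw [add_assoc x0, ← fac] at g2
    have hG : Good3 (phi A B C a (i + 1)) (phi A B C b j) (phi A B C c k) := ⟨g1, g2, h3⟩
    refine ⟨(i + 1, j, k), ⟨hgg, ⟨⟨by simp only; omega, by simp only; omega⟩, hj, hk, hG⟩, ?_⟩,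
      by simp only; omega, by simp only; omega⟩
    have hG' := hG
    rw [phi_succ] at hG'
    obtain ⟨x, e1, e2, e3, e4⟩ := link_nonempty hA hAB hBC hS hT hTc ⟨h1, h2, h3⟩ hG'
    rw [← phi_succ] at e2
    exact ⟨x, ⟨e1, e3, e4⟩, ⟨e2, e3, e4⟩⟩
  · right
    rw [add_assoc y0, ← fab] at g1
    rw [add_assoc y0, ← fbc] at g2
    have hG : Good3 (phi A B C a i) (phi A B C b (j + 1)) (phi A B C c k) := ⟨g1, h2, g2⟩
    refine ⟨(i, j + 1, k), ⟨hgg, ⟨hi, ⟨by simp only; omega, by simp only; omega⟩, hk, hG⟩, ?_⟩,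
      by simp only; omega, by simp only; omega⟩
    have hG' := hG.swap12
    rw [phi_succ] at hG'
    obtain ⟨x, e1, e2, e3, e4⟩ :=
      link_nonempty hA hAB hBC hS hT hTc (Good3.swap12 ⟨h1, h2, h3⟩) hG'
    rw [← phi_succ] at e2
    exact ⟨x, ⟨e3, e1, e4⟩, ⟨e3, e2, e4⟩⟩
  · right
    rw [add_assoc z0, ← fac] at g1
    rw [add_assoc z0, ← fbc] at g2
    have hG : Good3 (phi A B C a i) (phi A B C b j) (phi A B C c (k + 1)) := ⟨h1, g1, g2⟩
    refine ⟨(i, j, k + 1), ⟨hgg, ⟨hi, hj, ⟨by simp only; omega, by simp only; omega⟩, hG⟩, ?_⟩,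
      by simp only; omega, by simp only; omega⟩
    have hG' := hG.rot
    rw [phi_succ] at hG'
    obtain ⟨x, e1, e2, e3, e4⟩ :=
      link_nonempty hA hAB hBC hS hT hTc (Good3.rot ⟨h1, h2, h3⟩) hG'
    rw [← phi_succ] at e2
    exact ⟨x, ⟨e3, e4, e1⟩, ⟨e3, e4, e2⟩⟩

lemma link_chain {A B C : ℤ} {T : Set (Fin 3 → ℝ)} (hA : 1 ≤ A) (hAB : A ≤ B) (hBC : B < C)
    (hS : SelfSim A B C T) (hT : T.Nonempty) (hTc : IsCompact T) {a b c : ℤ × ℤ × ℤ}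
    (h : Good3 a b c) {g g' : ℤ × ℤ × ℤ} (hg : GoodG A B C a b c g)
    (hg' : GoodG A B C a b c g') : Relation.ReflTransGen (Link A B C T a b c) g g' := by
  have aux : ∀ (n : ℕ) (g g' : ℤ × ℤ × ℤ), GoodG A B C a b c g → GoodG A B C a b c g' →
      g.1 + g.2.1 + g.2.2 + n = g'.1 + g'.2.1 + g'.2.2 →
      Relation.ReflTransGen (Link A B C T a b c) g g' := by
    intro n
    induction n with
    | zero =>
      intro g g' hg hg' hs
      rcases link_step hA hAB hBC hS hT hTc h hg hg' (by omega) with rfl | ⟨g₁, _, h2, h3⟩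
      · exact Relation.ReflTransGen.refl
      · push_cast at hs
        omega
    | succ n ih =>
      intro g g' hg hg' hs
      rcases link_step hA hAB hBC hS hT hTc h hg hg' (by omega) with rfl | ⟨g₁, h1, h2, h3⟩
      · exact Relation.ReflTransGen.refl
      · exact (ih g₁ g' h1.2.1 hg' (by push_cast at hs; omega)).head h1
  have hsymm : Std.Symm (Link A B C T a b c) :=
    ⟨fun _ _ ⟨h1, h2, x, hx, hx'⟩ => ⟨h2, h1, x, hx', hx⟩⟩
  rcases le_total (g.1 + g.2.1 + g.2.2) (g'.1 + g'.2.1 + g'.2.2) with hle | hle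
  · obtain ⟨n, hn⟩ := Int.le.dest hle
    exact aux n g g' hg hg' hn
  · obtain ⟨n, hn⟩ := Int.le.dest hle
    exact (Relation.ReflTransGen.stdSymm (r := Link A B C T a b c)).symm _ _ (aux n g' g hg' hg hn)

/-! ### Connectedness and local connectedness of triple intersections -/

/-- The hypothesis that all neighbours are among the fourteen standard ones. -/
def OnlyS (A B : ℤ) (T : Set (Fin 3 → ℝ)) : Prop :=
  ∀ a b : ℤ × ℤ × ℤ, a ≠ b → ∀ x, x ∈ Tl A B T a → x ∈ Tl A B T b → InS (b - a)

lemma phi_ne {A B C : ℤ} {a b : ℤ × ℤ × ℤ} (h : a ≠ b) {i j : ℤ} (hi : 0 ≤ i ∧ i < C)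
    (hj : 0 ≤ j ∧ j < C) : phi A B C a i ≠ phi A B C b j := by
  intro he
  obtain ⟨p, q, n⟩ := a
  obtain ⟨p', q', n'⟩ := b
  simp only [phi, Prod.mk.injEq] at he
  obtain ⟨h1, rfl, rfl⟩ := he
  have h2 : C * (n - n') = i - j := by linarith
  have h3 : n - n' = 0 := by
    rcases lt_trichotomy (n - n') 0 with h | h | h
    · nlinarith
    · exact h
    · nlinarith
  apply h
  have : n = n' := by omega
  rw [this]

lemma InS.ne {a b : ℤ × ℤ × ℤ} (h : InS (b - a)) : a ≠ b := by
  rintro rfl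
  simp [InS] at h

lemma tri_subdiv {A B C : ℤ} {T : Set (Fin 3 → ℝ)} (hS : SelfSim A B C T) (hO : OnlyS A B T)
    {a b c : ℤ × ℤ × ℤ} (h : Good3 a b c) (x : Fin 3 → ℝ) :
    x ∈ Tri A B T a b c ↔ ∃ g, GoodG A B C a b c g ∧ ML A B C x ∈ TriG A B C T a b c g := by
  constructor
  · rintro ⟨ha, hb, hc⟩
    obtain ⟨i, hi0, hi, hai⟩ := (mem_Tl_iff hS _ _).1 ha
    obtain ⟨j, hj0, hj, hbj⟩ := (mem_Tl_iff hS _ _).1 hb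
    obtain ⟨k, hk0, hk, hck⟩ := (mem_Tl_iff hS _ _).1 hc
    refine ⟨(i, j, k), ⟨⟨hi0, hi⟩, ⟨hj0, hj⟩, ⟨hk0, hk⟩, ?_, ?_, ?_⟩, hai, hbj, hck⟩
    · exact hO _ _ (phi_ne h.1.ne ⟨hi0, hi⟩ ⟨hj0, hj⟩) _ hai hbj
    · exact hO _ _ (phi_ne h.2.1.ne ⟨hi0, hi⟩ ⟨hk0, hk⟩) _ hai hck
    · exact hO _ _ (phi_ne h.2.2.ne ⟨hj0, hj⟩ ⟨hk0, hk⟩) _ hbj hck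
  · rintro ⟨g, ⟨hi, hj, hk, _⟩, h1, h2, h3⟩
    exact ⟨(mem_Tl_iff hS _ _).2 ⟨_, hi.1, hi.2, h1⟩, (mem_Tl_iff hS _ _).2 ⟨_, hj.1, hj.2, h2⟩,
      (mem_Tl_iff hS _ _).2 ⟨_, hk.1, hk.2, h3⟩⟩

lemma isCompact_Tri {A B : ℤ} {T : Set (Fin 3 → ℝ)} (hT : IsCompact T) (a b c : ℤ × ℤ × ℤ) :
    IsCompact (Tri A B T a b c) :=
  (isCompact_Tl hT a).inter_right ((isClosed_Tl hT b).inter (isClosed_Tl hT c))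

lemma tri_bound {A B : ℤ} {T : Set (Fin 3 → ℝ)} (hTc : IsCompact T) :
    ∃ R : ℝ, ∀ a b c : ℤ × ℤ × ℤ, ∀ x ∈ Tri A B T a b c, ∀ y ∈ Tri A B T a b c, ‖x - y‖ ≤ R := by
  refine ⟨Metric.diam T, fun a b c x hx y hy => ?_⟩
  have := Metric.dist_le_diam_of_mem hTc.isBounded hx.1 hy.1
  rwa [dist_eq_norm, sub_sub_sub_cancel_right] at this

lemma tri_chain {A B C : ℤ} {T : Set (Fin 3 → ℝ)} (hA : 1 ≤ A) (hAB : A ≤ B) (hBC : B < C)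
    (hS : SelfSim A B C T) (hT : T.Nonempty) (hTc : IsCompact T) (hO : OnlyS A B T) {R : ℝ}
    (hR : ∀ a b c : ℤ × ℤ × ℤ, ∀ x ∈ Tri A B T a b c, ∀ y ∈ Tri A B T a b c, ‖x - y‖ ≤ R)
    (n : ℕ) : ∀ a b c : ℤ × ℤ × ℤ, Good3 a b c → ∀ x ∈ Tri A B T a b c, ∀ y ∈ Tri A B T a b c,
      Relation.ReflTransGen (fun u v => u ∈ Tri A B T a b c ∧ v ∈ Tri A B T a b c ∧
        ‖(ML A B C ^ n) (u - v)‖ ≤ R) x y := by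
  have hC : 0 < C := by omega
  induction n with
  | zero =>
    intro a b c h x hx y hy
    exact Relation.ReflTransGen.single ⟨hx, hy, by simpa using hR a b c x hx y hy⟩
  | succ n ih =>
    intro a b c h x hx y hy
    have one : ∀ g, GoodG A B C a b c g → ∀ u ∈ TriG A B C T a b c g, ∀ v ∈ TriG A B C T a b c g,
        Relation.ReflTransGen (fun u v => u ∈ Tri A B T a b c ∧ v ∈ Tri A B T a b c ∧
        ‖(ML A B C ^ (n + 1)) (u - v)‖ ≤ R) (NL A B C u) (NL A B C v) := by
      intro g hg u hu v hv
      refine Relation.ReflTransGen.lift (NL A B C) ?_ _ _ (ih _ _ _ hg.2.2.2 u hu v hv)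
      rintro u v ⟨hu, hv, huv⟩
      refine ⟨(tri_subdiv hS hO h _).2 ⟨g, hg, ?_⟩, (tri_subdiv hS hO h _).2 ⟨g, hg, ?_⟩, ?_⟩
      · rw [ML_NL hC]; exact hu
      · rw [ML_NL hC]; exact hv
      · rw [pow_succ, Module.End.mul_apply, map_sub, ML_NL hC, ML_NL hC]
        exact huv
    obtain ⟨g, hg, hxg⟩ := (tri_subdiv hS hO h x).1 hx
    obtain ⟨g', hg', hyg⟩ := (tri_subdiv hS hO h y).1 hy
    have many : ∀ g', Relation.ReflTransGen (Link A B C T a b c) g g' → GoodG A B C a b c g' →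
        ∀ v ∈ TriG A B C T a b c g',
        Relation.ReflTransGen (fun u v => u ∈ Tri A B T a b c ∧ v ∈ Tri A B T a b c ∧
        ‖(ML A B C ^ (n + 1)) (u - v)‖ ≤ R) x (NL A B C v) := by
      intro g' hgg'
      induction hgg' with
      | refl =>
        intro _ v hv
        have := one g hg _ hxg v hv
        rwa [NL_ML hC] at this
      | @tail g₁ g₂ _ hl ih2 =>
        intro _ v hv
        obtain ⟨h1, h2, z, hz1, hz2⟩ := hl
        exact (ih2 h1 z hz1).trans (one g₂ h2 z hz2 v hv)
    have := many g' (link_chain hA hAB hBC hS hT hTc h hg hg') hg' _ hyg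
    rwa [NL_ML hC] at this

lemma tri_preconnected {A B C : ℤ} {T : Set (Fin 3 → ℝ)} (hA : 1 ≤ A) (hAB : A ≤ B) (hBC : B < C)
    (hS : SelfSim A B C T) (hT : T.Nonempty) (hTc : IsCompact T) (hO : OnlyS A B T)
    (a b c : ℤ × ℤ × ℤ) (h : Good3 a b c) : IsPreconnected (Tri A B T a b c) := by
  obtain ⟨R, hR⟩ := tri_bound (A := A) (B := B) hTc
  refine preconnected_of_chain (isCompact_Tri hTc a b c) ?_
  intro ε hε x hx y hy
  obtain ⟨n, hn⟩ := expanding hA hAB hBC R ε hε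
  refine Relation.ReflTransGen.mono ?_ _ _ (tri_chain hA hAB hBC hS hT hTc hO hR n a b c h x hx y hy)
  rintro u v ⟨hu, hv, huv⟩
  exact ⟨hu, hv, by rw [dist_eq_norm]; exact hn _ huv⟩

lemma goodG_finite (A B C : ℤ) (a b c : ℤ × ℤ × ℤ) : {g | GoodG A B C a b c g}.Finite := by
  refine Set.Finite.subset
    ((Set.finite_Ico (0 : ℤ) C).prod ((Set.finite_Ico (0 : ℤ) C).prod (Set.finite_Ico (0 : ℤ) C))) ?_
  rintro g ⟨h1, h2, h3, _⟩
  exact ⟨h1, h2, h3⟩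

lemma tri_cover {A B C : ℤ} {T : Set (Fin 3 → ℝ)} (hA : 1 ≤ A) (hAB : A ≤ B) (hBC : B < C)
    (hS : SelfSim A B C T) (hT : T.Nonempty) (hTc : IsCompact T) (hO : OnlyS A B T) {R : ℝ}
    (hR : ∀ a b c : ℤ × ℤ × ℤ, ∀ x ∈ Tri A B T a b c, ∀ y ∈ Tri A B T a b c, ‖x - y‖ ≤ R)
    (n : ℕ) : ∀ a b c : ℤ × ℤ × ℤ, Good3 a b c →
      ∃ P : Set (Set (Fin 3 → ℝ)), P.Finite ∧ ⋃₀ P = Tri A B T a b c ∧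
        ∀ p ∈ P, IsClosed p ∧ IsPreconnected p ∧
          ∀ x ∈ p, ∀ y ∈ p, ‖(ML A B C ^ n) (x - y)‖ ≤ R := by
  have hC : 0 < C := by omega
  induction n with
  | zero =>
    intro a b c h
    refine ⟨{Tri A B T a b c}, Set.finite_singleton _, Set.sUnion_singleton _, ?_⟩
    rintro p rfl
    exact ⟨(isCompact_Tri hTc a b c).isClosed, tri_preconnected hA hAB hBC hS hT hTc hO a b c h,
      by simpa using hR a b c⟩
  | succ n ih =>
    intro a b c h
    have ih' : ∀ g : {g // GoodG A B C a b c g}, ∃ P : Set (Set (Fin 3 → ℝ)), P.Finite ∧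
        ⋃₀ P = TriG A B C T a b c g ∧ ∀ p ∈ P, IsClosed p ∧ IsPreconnected p ∧
          ∀ x ∈ p, ∀ y ∈ p, ‖(ML A B C ^ n) (x - y)‖ ≤ R := fun g => ih _ _ _ g.2.2.2.2
    choose P hPf hPc hP using ih'
    have hfin : Finite {g // GoodG A B C a b c g} := goodG_finite A B C a b c
    have hMc : Continuous (ML A B C) := LinearMap.continuous_of_finiteDimensional _
    have hNc : Continuous (NL A B C) := LinearMap.continuous_of_finiteDimensional _
    refine ⟨⋃ g, (fun p => ML A B C ⁻¹' p) '' P g, Set.finite_iUnion (fun g => (hPf g).image _),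
      ?_, ?_⟩
    · ext x
      rw [tri_subdiv hS hO h]
      constructor
      · rintro ⟨q, hq, hxq⟩
        obtain ⟨g, hg⟩ := Set.mem_iUnion.1 hq
        obtain ⟨p, hp, rfl⟩ := hg
        refine ⟨g, g.2, ?_⟩
        rw [← hPc g]
        exact ⟨p, hp, hxq⟩
      · rintro ⟨g, hg, hx⟩
        have hx' : ML A B C x ∈ ⋃₀ P ⟨g, hg⟩ := by rw [hPc]; exact hx
        obtain ⟨p, hp, hxp⟩ := hx'
        exact ⟨_, Set.mem_iUnion.2 ⟨⟨g, hg⟩, p, hp, rfl⟩, hxp⟩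
    · intro q hq
      obtain ⟨g, p, hp, rfl⟩ := Set.mem_iUnion.1 hq
      obtain ⟨h1, h2, h3⟩ := hP g p hp
      refine ⟨h1.preimage hMc, ?_, ?_⟩
      · have : (fun p => ML A B C ⁻¹' p) p = NL A B C '' p := by
          ext x
          constructor
          · intro hx
            exact ⟨_, hx, NL_ML hC x⟩
          · rintro ⟨y, hy, rfl⟩
            change ML A B C (NL A B C y) ∈ p
            rwa [ML_NL hC]
        rw [this]
        exact h2.image _ hNc.continuousOn
      · intro x hx y hy
        rw [pow_succ, Module.End.mul_apply, map_sub]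
        exact h3 _ hx _ hy

lemma tri_locallyConnected {A B C : ℤ} {T : Set (Fin 3 → ℝ)} (hA : 1 ≤ A) (hAB : A ≤ B)
    (hBC : B < C) (hS : SelfSim A B C T) (hT : T.Nonempty) (hTc : IsCompact T) (hO : OnlyS A B T)
    (a b c : ℤ × ℤ × ℤ) (h : Good3 a b c) : LocallyConnectedSpace (Tri A B T a b c) := by
  obtain ⟨R, hR⟩ := tri_bound (A := A) (B := B) hTc
  refine locallyConnected_of_cover fun ε hε => ?_
  obtain ⟨n, hn⟩ := expanding hA hAB hBC R ε hε
  obtain ⟨P, hPf, hPc, hP⟩ := tri_cover hA hAB hBC hS hT hTc hO hR n a b c h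
  refine ⟨P, hPf, hPc, fun p hp => ⟨(hP p hp).1, (hP p hp).2.1, fun x hx y hy => ?_⟩⟩
  rw [dist_eq_norm]
  exact hn _ ((hP p hp).2.2 x hx y hy)

/-! ### The neighbour set -/

/-- Coordinates of a lattice vector with respect to `P, Q, N`. -/
def coord (A B : ℤ) (α : Fin 3 → ℤ) : ℤ × ℤ × ℤ :=
  (α 0 - A * (α 1 - A * α 2) - B * α 2, α 1 - A * α 2, α 2)

/-- Inverse of `coord`. -/
def vec (A B : ℤ) (v : ℤ × ℤ × ℤ) : Fin 3 → ℤ :=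
  ![v.1 + A * v.2.1 + B * v.2.2, v.2.1 + A * v.2.2, v.2.2]

lemma coord_vec (A B : ℤ) (v : ℤ × ℤ × ℤ) : coord A B (vec A B v) = v := by
  ext <;> simp [coord, vec]
  ring

lemma vec_coord (A B : ℤ) (α : Fin 3 → ℤ) : vec A B (coord A B α) = α := by
  ext i
  fin_cases i <;> simp [coord, vec]
  ring

lemma pos_coord (A B : ℤ) (α : Fin 3 → ℤ) : pos A B (coord A B α) = toR α := by
  ext i
  fin_cases i <;> simp [coord, pos, toR]
  ring

lemma coord_ne {A B : ℤ} {α β : Fin 3 → ℤ} (h : α ≠ β) : coord A B α ≠ coord A B β := by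
  intro he
  apply h
  rw [← vec_coord A B α, he, vec_coord]

lemma translate_eq (A B : ℤ) (T : Set (Fin 3 → ℝ)) (α : Fin 3 → ℤ) :
    tileTranslate (toR α) T = Tl A B T (coord A B α) := by
  ext x
  simp only [tileTranslate, Tl, pos_coord]
  constructor
  · rintro ⟨y, hy, rfl⟩
    simpa using hy
  · intro hx
    exact ⟨_, hx, sub_add_cancel _ _⟩

lemma Tl_zero (A B : ℤ) (T : Set (Fin 3 → ℝ)) : Tl A B T 0 = T := by
  ext x
  have : pos A B 0 = 0 := by
    ext i
    fin_cases i <;> simp [pos]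
  simp [Tl, this]

/-- The standard neighbours as a finite set. -/
def S14 : Finset (ℤ × ℤ × ℤ) :=
  {(1, 0, 0), (-1, 0, 0), (0, 1, 0), (-1, 1, 0), (0, -1, 0), (1, -1, 0), (0, 0, 1), (-1, 0, 1),
    (0, 0, -1), (1, 0, -1), (0, -1, 1), (1, -1, 1), (0, 1, -1), (-1, 1, -1)}

lemma mem_S14 {v : ℤ × ℤ × ℤ} (h : v ∈ S14) : InS v := by
  simp only [S14, Finset.mem_insert, Finset.mem_singleton] at h
  rcases h with rfl | rfl | rfl | rfl | rfl | rfl | rfl | rfl | rfl | rfl | rfl | rfl | rfl | rfl <;>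
    simp [InS]

/-- Two lattice points whose tiles intersect. -/
def Meet (A B : ℤ) (T : Set (Fin 3 → ℝ)) (v : ℤ × ℤ × ℤ) : Prop :=
  ∃ x, x ∈ Tl A B T 0 ∧ x ∈ Tl A B T v

lemma meet_sub {A B : ℤ} {T : Set (Fin 3 → ℝ)} {a b : ℤ × ℤ × ℤ} {x : Fin 3 → ℝ}
    (ha : x ∈ Tl A B T a) (hb : x ∈ Tl A B T b) : Meet A B T (b - a) := by
  refine ⟨x - pos A B a, ?_, ?_⟩
  · rw [← mem_Tl_add 0 a]
    simpa using ha
  · rw [← mem_Tl_add _ a]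
    simpa using hb

lemma meet_S14 {A B C : ℤ} {T : Set (Fin 3 → ℝ)} (hA : 1 ≤ A) (hAB : A ≤ B) (hBC : B < C)
    (hS : SelfSim A B C T) (hT : T.Nonempty) (hTc : IsCompact T) {v : ℤ × ℤ × ℤ}
    (hv : v ∈ S14) : Meet A B T v := by
  obtain ⟨x, hx⟩ := quad_nonempty hA hAB hBC hS hT hTc 0 (0, 1, 0) (0, 0, 1) (by simp [Edge])
  obtain ⟨y, hy⟩ := quad_nonempty hA hAB hBC hS hT hTc 0 (0, 0, 1) (1, -1, 1) (by simp [Edge])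
  have hX : ∀ m m', Meet A B T (quad 0 (0, 1, 0) (0, 0, 1) m' - quad 0 (0, 1, 0) (0, 0, 1) m) :=
    fun m m' => meet_sub (hx m) (hx m')
  have hY : ∀ m m', Meet A B T (quad 0 (0, 0, 1) (1, -1, 1) m' - quad 0 (0, 0, 1) (1, -1, 1) m) :=
    fun m m' => meet_sub (hy m) (hy m')
  simp only [S14, Finset.mem_insert, Finset.mem_singleton] at hv
  rcases hv with rfl | rfl | rfl | rfl | rfl | rfl | rfl | rfl | rfl | rfl | rfl | rfl | rfl | rfl
  · exact hX 0 1
  · exact hX 1 0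
  · exact hX 0 2
  · exact hX 1 2
  · exact hX 2 0
  · exact hX 2 1
  · exact hX 0 3
  · exact hX 1 3
  · exact hX 3 0
  · exact hX 3 1
  · exact hX 2 3
  · exact hY 0 3
  · exact hX 3 2
  · exact hY 3 0

lemma onlyS_of_ncard {A B C : ℤ} {T : Set (Fin 3 → ℝ)} (hA : 1 ≤ A) (hAB : A ≤ B) (hBC : B < C)
    (hS : SelfSim A B C T) (hT : T.Nonempty) (hTc : IsCompact T)
    (h14 : (Neighbors T).ncard = 14) : OnlyS A B T := by
  have hinj : Function.Injective (vec A B) := fun v w h => by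
    rw [← coord_vec A B v, h, coord_vec]
  have hcard : (vec A B '' (S14 : Set (ℤ × ℤ × ℤ))).ncard = 14 := by
    rw [Set.ncard_image_of_injective _ hinj, Set.ncard_coe_finset]
    decide
  have hsub : vec A B '' (S14 : Set (ℤ × ℤ × ℤ)) ⊆ Neighbors T := by
    rintro _ ⟨v, hv, rfl⟩
    obtain ⟨x, hx0, hx⟩ := meet_S14 hA hAB hBC hS hT hTc hv
    refine ⟨?_, x, ?_, ?_⟩
    · intro h0
      have h1 : v = coord A B 0 := by rw [← h0, coord_vec]
      have h2 := mem_S14 hv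
      rw [h1] at h2
      simp [InS, coord] at h2
    · rwa [Tl_zero] at hx0
    · rwa [translate_eq A B, coord_vec]
  have hfin : (Neighbors T).Finite := Set.finite_of_ncard_ne_zero (by rw [h14]; norm_num)
  have heq := Set.eq_of_subset_of_ncard_le hsub (by rw [h14, hcard]) hfin
  intro a b hab x hxa hxb
  obtain ⟨y, hy0, hy⟩ := meet_sub hxa hxb
  have hmem : vec A B (b - a) ∈ Neighbors T := by
    refine ⟨?_, y, by rwa [Tl_zero] at hy0, by rwa [translate_eq A B, coord_vec]⟩
    intro h0
    have h1 : b - a = coord A B 0 := by rw [← h0, coord_vec]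
    have h2 : coord A B 0 = 0 := by ext <;> simp [coord]
    rw [h2, sub_eq_zero] at h1
    exact hab h1.symm
  rw [← heq] at hmem
  obtain ⟨v, hv, hve⟩ := hmem
  rw [← hinj hve]
  exact mem_S14 hv

theorem stmt14 (A B C : ℤ) (T : Set (Fin 3 → ℝ)) (hT : IsABCTile A B C T)
    (h14 : (Neighbors T).ncard = 14) (α β : Fin 3 → ℤ) (hα : α ≠ 0) (hβ : β ≠ 0)
    (hne : α ≠ β) (hint : (T ∩ tileTranslate (toR α) T ∩ tileTranslate (toR β) T).Nonempty) :
    IsCompact (T ∩ tileTranslate (toR α) T ∩ tileTranslate (toR β) T) ∧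
    IsConnected (T ∩ tileTranslate (toR α) T ∩ tileTranslate (toR β) T) ∧
    LocallyConnectedSpace (T ∩ tileTranslate (toR α) T ∩ tileTranslate (toR β) T :
      Set (Fin 3 → ℝ)) := by

  obtain ⟨hA, hAB, hBC, hTne, hTc, _, hset⟩ := hT
  have hS : SelfSim A B C T := selfSim_of_tile (by omega) hset
  have hO : OnlyS A B T := onlyS_of_ncard hA hAB hBC hS hTne hTc h14
  have h0 : coord A B 0 = 0 := by ext <;> simp [coord]
  have hX : T ∩ tileTranslate (toR α) T ∩ tileTranslate (toR β) T
      = Tri A B T 0 (coord A B α) (coord A B β) := by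
    rw [translate_eq A B, translate_eq A B]
    ext x
    simp only [Tri, Tl_zero, Set.mem_inter_iff, Set.mem_ofPred_eq, and_assoc]
  rw [hX] at hint ⊢
  have hG : Good3 0 (coord A B α) (coord A B β) := by
    obtain ⟨x, hx1, hx2, hx3⟩ := hint
    refine ⟨hO _ _ ?_ x hx1 hx2, hO _ _ ?_ x hx1 hx3, hO _ _ (coord_ne hne) x hx2 hx3⟩
    · rw [← h0]
      exact coord_ne hα.symm
    · rw [← h0]
      exact coord_ne hβ.symm
  exact ⟨isCompact_Tri hTc _ _ _,
    ⟨hint, tri_preconnected hA hAB hBC hS hTne hTc hO _ _ _ hG⟩,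
    tri_locallyConnected hA hAB hBC hS hTne hTc hO _ _ _ hG⟩
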